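/- Let E_+ = (E_{+,1},…,E_{+,d}) be a d-tuple of edge sets on the finite box set V satisfying P3 (the intersection of the E_{+,i} is empty). Then E_+ is a packing class for (V,w) if and only if for every i ∈ {1,…,d}: (1) the graph (V, E_{+,i}) does not contain C_4 as an induced subgraph; (2) the complement graph (V, complement of E_{+,i}) does not contain an odd 2-chordless cycle; and (3) the complement graph (V, complement of E_{+,i}) does not contain an x_i-infeasible clique. -/

import Mathlib

def IsIntervalGraph {V : Type*} (G : SimpleGraph V) : Prop :=
  ∃ lo hi : V → ℝ, (∀ v, lo v ≤ hi v) ∧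
    ∀ u v : V, u ≠ v →
      (G.Adj u v ↔ (Set.Icc (lo u) (hi u) ∩ Set.Icc (lo v) (hi v)).Nonempty)

def IsPackingClass {V : Type*} [Fintype V] {d : ℕ} (w : V → Fin d → ℝ)
    (G : Fin d → SimpleGraph V) : Prop :=
  (∀ i, IsIntervalGraph (G i)) ∧
  (∀ i : Fin d, ∀ S : Finset V,
      (∀ u ∈ S, ∀ v ∈ S, u ≠ v → ¬ (G i).Adj u v) → ∑ v ∈ S, w v i ≤ 1) ∧
  (∀ b c : V, ¬ ∀ i, (G i).Adj b c)

def IsPacking {V : Type*} {d : ℕ} (w p : V → Fin d → ℝ) : Prop :=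
  (∀ v i, 0 ≤ p v i ∧ p v i + w v i ≤ 1) ∧
  ∀ b c : V, b ≠ c → ∃ i,
    Set.Ico (p b i) (p b i + w b i) ∩ Set.Ico (p c i) (p c i + w c i) = ∅

def InSearchSpace {V : Type*} [Fintype V] {d : ℕ} (w : V → Fin d → ℝ)
    (Ep Em : Fin d → Set (Sym2 V)) (F : Fin d → SimpleGraph V) : Prop :=
  IsPackingClass w F ∧ ∀ j, Ep j ⊆ (F j).edgeSet ∧ (F j).edgeSet ⊆ (Em j)ᶜ

def IndistBoxes {V : Type*} {d : ℕ} (w : V → Fin d → ℝ)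
    (Ep Em : Fin d → Set (Sym2 V)) (b c : V) : Prop :=
  w b = w c ∧ ∀ i : Fin d, ∀ z : V, z ≠ b → z ≠ c →
    ((s(b, z) ∈ Ep i ↔ s(c, z) ∈ Ep i) ∧ (s(b, z) ∈ Em i ↔ s(c, z) ∈ Em i))

def IndistEdges {V : Type*} {d : ℕ} (w : V → Fin d → ℝ)
    (Ep Em : Fin d → Set (Sym2 V)) (e e' : Sym2 V) : Prop :=
  ∃ b c b' c' : V, e = s(b, c) ∧ e' = s(b', c') ∧
    IndistBoxes w Ep Em b b' ∧ IndistBoxes w Ep Em c c'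

def PackingClassIso {V : Type*} {d : ℕ} (w : V → Fin d → ℝ)
    (F F' : Fin d → SimpleGraph V) : Prop :=
  ∃ π : Equiv.Perm V, (∀ b, w (π b) = w b) ∧
    ∀ j b c, (F j).Adj b c ↔ (F' j).Adj (π b) (π c)

def IsComparability {V : Type*} (G : SimpleGraph V) : Prop :=
  ∃ F : Set (V × V), (∀ b c : V, G.Adj b c ↔ Xor' ((b, c) ∈ F) ((c, b) ∈ F)) ∧
    ∀ b c z : V, (b, c) ∈ F → (c, z) ∈ F → (b, z) ∈ F

def HasInducedC4 {V : Type*} (G : SimpleGraph V) : Prop :=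
  ∃ b0 b1 b2 b3 : V, b0 ≠ b1 ∧ b0 ≠ b2 ∧ b0 ≠ b3 ∧ b1 ≠ b2 ∧ b1 ≠ b3 ∧ b2 ≠ b3 ∧
    G.Adj b0 b1 ∧ G.Adj b1 b2 ∧ G.Adj b2 b3 ∧ G.Adj b3 b0 ∧
    ¬ G.Adj b0 b2 ∧ ¬ G.Adj b1 b3

def HasOdd2ChordlessCycle {V : Type*} (G : SimpleGraph V) : Prop :=
  ∃ k : ℕ, Odd k ∧ ∃ b : ZMod k → V,
    (∀ j, G.Adj (b j) (b (j + 1))) ∧ ∀ j, ¬ G.Adj (b j) (b (j + 2))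

section Intervals

variable {V : Type*}

theorem Icc_inter_Icc_nonempty_iff {a b c d : ℝ} (hab : a ≤ b) (hcd : c ≤ d) :
    (Set.Icc a b ∩ Set.Icc c d).Nonempty ↔ a ≤ d ∧ c ≤ b := by
  rw [Set.Icc_inter_Icc, Set.nonempty_Icc, sup_le_iff, le_inf_iff, le_inf_iff]
  tauto

theorem IsIntervalGraph.not_hasInducedC4 {G : SimpleGraph V} (h : IsIntervalGraph G) :
    ¬ HasInducedC4 G := by
  obtain ⟨lo, hi, hle, hG⟩ := h
  have key : ∀ u v, u ≠ v → (G.Adj u v ↔ lo u ≤ hi v ∧ lo v ≤ hi u) := fun u v huv => by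
    rw [hG u v huv, Icc_inter_Icc_nonempty_iff (hle u) (hle v)]
  rintro ⟨b0, b1, b2, b3, h01, h02, h03, h12, h13, h23, a01, a12, a23, a30, n02, n13⟩
  rw [key _ _ h01] at a01
  rw [key _ _ h12] at a12
  rw [key _ _ h23] at a23
  rw [key _ _ h03.symm] at a30
  rw [key _ _ h02, not_and_or, not_le, not_le] at n02
  rw [key _ _ h13, not_and_or, not_le, not_le] at n13
  rcases n02 with n02 | n02 <;> rcases n13 with n13 | n13 <;> linarith

theorem IsIntervalGraph.isComparability_compl {G : SimpleGraph V} (h : IsIntervalGraph G) :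
    IsComparability Gᶜ := by
  obtain ⟨lo, hi, hle, hG⟩ := h
  refine ⟨{p | hi p.1 < lo p.2}, fun b c => ?_, fun b c z hbc hcz => ?_⟩
  · rw [SimpleGraph.compl_adj]
    simp only [Set.mem_ofPred_eq]
    have hb := hle b
    have hc := hle c
    by_cases hne : b = c
    · subst hne
      exact iff_of_false (fun h => h.1 rfl) (fun h => h.elim (fun h => h.2 h.1) (fun h => h.2 h.1))
    · rw [hG b c hne, Icc_inter_Icc_nonempty_iff hb hc, not_and_or, not_le, not_le]
      constructor
      · rintro ⟨-, h | h⟩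
        · exact Or.inr ⟨h, by linarith⟩
        · exact Or.inl ⟨h, by linarith⟩
      · rintro (⟨h, -⟩ | ⟨h, -⟩)
        · exact ⟨hne, Or.inr h⟩
        · exact ⟨hne, Or.inl h⟩
  · simp only [Set.mem_ofPred_eq] at *
    linarith [hle c]

theorem IsComparability.exists_isStrictOrder {H : SimpleGraph V} (h : IsComparability H) :
    ∃ r : V → V → Prop, IsStrictOrder V r ∧ ∀ b c, H.Adj b c ↔ r b c ∨ r c b := by
  obtain ⟨F, hF, htrans⟩ := h
  refine ⟨fun b c => H.Adj b c ∧ (b, c) ∈ F,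
    { irrefl := fun b hb => H.irrefl hb.1, trans := ?_ }, fun b c => ?_⟩
  · rintro b c z ⟨abc, hbc⟩ ⟨acz, hcz⟩
    have hbz := htrans b c z hbc hcz
    refine ⟨(hF b z).2 (Or.inl ⟨hbz, fun hzb => ?_⟩), hbz⟩
    rcases (hF c z).1 acz with h | h
    · exact h.2 (htrans z b c hzb hbc)
    · exact h.2 hcz
  · constructor
    · intro h
      rcases (hF b c).1 h with h' | h'
      · exact Or.inl ⟨h, h'.1⟩
      · exact Or.inr ⟨h.symm, h'.1⟩
    · rintro (h | h)
      · exact h.1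
      · exact h.1.symm

theorem IsComparability.not_hasOdd2ChordlessCycle {H : SimpleGraph V} (h : IsComparability H) :
    ¬ HasOdd2ChordlessCycle H := by
  obtain ⟨r, _, hr⟩ := h.exists_isStrictOrder
  rintro ⟨k, hk, b, hadj, hchord⟩
  have alternate : ∀ j, r (b (j + 1)) (b (j + 1 + 1)) ↔ ¬ r (b j) (b (j + 1)) := by
    intro j
    have h1 := (hr _ _).1 (hadj j)
    have h2 := (hr _ _).1 (hadj (j + 1))
    have h3 : j + 1 + 1 = j + 2 := by ring
    rw [h3] at h2 ⊢
    have hno := fun h => hchord j ((hr _ _).2 h)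
    constructor
    · exact fun h h' => hno (Or.inl (_root_.trans h' h))
    · intro h
      refine h2.resolve_right fun h' => hno (Or.inr ?_)
      exact _root_.trans h' (h1.resolve_left h)
  have parity : ∀ n : ℕ, (r (b n) (b (n + 1)) ↔ (Even n ↔ r (b 0) (b (0 + 1)))) := by
    intro n
    induction n with
    | zero => simp
    | succ n ih =>
      push_cast
      rw [alternate, ih, Nat.even_add_one]
      tauto
  have := parity k
  rw [ZMod.natCast_self] at this
  have hk' := Nat.not_even_iff_odd.2 hk
  tauto

/-- A finite interval order is represented by intervals whose left endpoints count
predecessors. -/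
theorem IsComparability.isIntervalGraph_of_compl [Finite V] {G : SimpleGraph V}
    (h : IsComparability Gᶜ) (hC4 : ¬ HasInducedC4 G) : IsIntervalGraph G := by
  classical
  have := Fintype.ofFinite V
  obtain ⟨r, _, hr⟩ := h.exists_isStrictOrder
  have adj_iff : ∀ u v, u ≠ v → (G.Adj u v ↔ ¬ (r u v ∨ r v u)) := fun u v huv => by
    rw [← hr, SimpleGraph.compl_adj]
    tauto
  have two_add_two : ∀ a v b w, r a v → r b w → r a w ∨ r b v := by
    intro a v b w hav hbw
    by_contra! hno
    obtain ⟨haw, hbv⟩ := hno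
    have hab : a ≠ b := by rintro rfl; exact haw hbw
    have hvw : v ≠ w := by rintro rfl; exact haw hav
    have haw' : a ≠ w := by rintro rfl; exact hbv (_root_.trans hbw hav)
    have hbv' : b ≠ v := by rintro rfl; exact haw (_root_.trans hav hbw)
    have hav' : a ≠ v := by rintro rfl; exact irrefl a hav
    have hbw' : b ≠ w := by rintro rfl; exact irrefl b hbw
    refine hC4 ⟨a, b, v, w, hab, hav', haw', hbv', hbw', hvw,
      (adj_iff _ _ hab).2 ?_, (adj_iff _ _ hbv').2 ?_, (adj_iff _ _ hvw).2 ?_,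
      (adj_iff _ _ haw'.symm).2 ?_, fun h => (adj_iff _ _ hav').1 h (Or.inl hav),
      fun h => (adj_iff _ _ hbw').1 h (Or.inl hbw)⟩
    · rintro (h | h)
      · exact haw (_root_.trans h hbw)
      · exact hbv (_root_.trans h hav)
    · rintro (h | h)
      · exact hbv h
      · exact haw (_root_.trans hav (_root_.trans h hbw))
    · rintro (h | h)
      · exact haw (_root_.trans hav h)
      · exact hbv (_root_.trans hbw h)
    · rintro (h | h)
      · exact hbv (_root_.trans hbw (_root_.trans h hav))
      · exact haw h
  let pred : V → Finset V := fun v => Finset.univ.filter (r · v)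
  have mem_pred : ∀ u v, u ∈ pred v ↔ r u v := fun u v => by simp [pred]
  have lt_of_not : ∀ u v w, r u w → ¬ r u v → (pred v).card < (pred w).card := by
    intro u v w huw huv
    refine Finset.card_lt_card ⟨fun a ha => ?_, fun hsub => ?_⟩
    · exact (mem_pred a w).2 ((two_add_two a v u w ((mem_pred a v).1 ha) huw).resolve_right huv)
    · exact huv ((mem_pred u v).1 (hsub ((mem_pred u w).2 huw)))
  let last : V → ℕ := fun u => (Finset.univ.filter (¬ r u ·)).sup fun v => (pred v).card
  have le_last : ∀ u v, ((pred v).card ≤ last u ↔ ¬ r u v) := by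
    intro u v
    constructor
    · intro h huv
      have hu : u ∈ Finset.univ.filter (¬ r u ·) := by simp [irrefl]
      obtain ⟨x, hx, hxe⟩ := Finset.exists_mem_eq_sup _ ⟨u, hu⟩ fun v => (pred v).card
      have := lt_of_not u x v huv (by simpa using hx)
      change _ ≤ Finset.sup _ _ at h
      omega
    · intro h
      exact Finset.le_sup (f := fun v => (pred v).card) (by simpa using h)
  refine ⟨fun v => (pred v).card, fun v => last v,
    fun v => Nat.cast_le.2 ((le_last v v).2 (irrefl v)), fun u v huv => ?_⟩
  rw [Icc_inter_Icc_nonempty_iff (Nat.cast_le.2 ((le_last u u).2 (irrefl u)))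
    (Nat.cast_le.2 ((le_last v v).2 (irrefl v))), Nat.cast_le, Nat.cast_le, le_last, le_last,
    adj_iff u v huv]
  tauto

end Intervals

section Forcing

variable {V : Type*}

/-- Two ordered pairs are in the relation when a transitive orientation containing the first
must contain the second, because they share an endpoint and the other endpoints are not
adjacent. -/
def Forces (H : SimpleGraph V) (e f : V × V) : Prop :=
  H.Adj e.1 e.2 ∧ H.Adj f.1 f.2 ∧
    ((e.1 = f.1 ∧ ¬ H.Adj e.2 f.2) ∨ (e.2 = f.2 ∧ ¬ H.Adj e.1 f.1))

def SameClass (H : SimpleGraph V) : V × V → V × V → Prop :=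
  Relation.ReflTransGen (Forces H)

variable {H : SimpleGraph V}

theorem Forces.symm {e f : V × V} (h : Forces H e f) : Forces H f e := by
  obtain ⟨he, hf, h | h⟩ := h
  · exact ⟨hf, he, Or.inl ⟨h.1.symm, fun h' => h.2 h'.symm⟩⟩
  · exact ⟨hf, he, Or.inr ⟨h.1.symm, fun h' => h.2 h'.symm⟩⟩

theorem Forces.swap {e f : V × V} (h : Forces H e f) : Forces H e.swap f.swap :=
  ⟨h.1.symm, h.2.1.symm, h.2.2.symm⟩

theorem SameClass.symm {e f : V × V} (h : SameClass H e f) : SameClass H f e := by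
  have : Std.Symm (Forces H) := ⟨fun _ _ => Forces.symm⟩
  exact Relation.ReflTransGen.stdSymm.symm _ _ h

theorem SameClass.trans {e f g : V × V} (h : SameClass H e f) (h' : SameClass H f g) :
    SameClass H e g :=
  Relation.ReflTransGen.trans h h'

theorem SameClass.swap {e f : V × V} (h : SameClass H e f) : SameClass H e.swap f.swap :=
  Relation.ReflTransGen.lift Prod.swap (fun _ _ => Forces.swap) _ _ h

theorem SameClass.adj {e f : V × V} (h : SameClass H e f) (he : H.Adj e.1 e.2) :
    H.Adj f.1 f.2 := by
  induction h with
  | refl => exact he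
  | tail _ h _ => exact h.2.1

/-- The triangle lemma for implication classes. -/
theorem SameClass.triangle {a b c : V} {e : V × V} (hab : H.Adj a b) (hca : H.Adj c a)
    (hb : ¬ SameClass H (b, c) (b, a)) (hc : ¬ SameClass H (b, c) (a, c))
    (h : SameClass H (b, c) e) :
    SameClass H (a, b) (a, e.1) ∧ SameClass H (c, a) (e.2, a) := by
  induction h with
  | refl => exact ⟨.refl, .refl⟩
  | @tail f g hf hfg ih =>
    obtain ⟨f1, f2⟩ := f
    obtain ⟨g1, g2⟩ := g
    obtain ⟨hf_adj, hg_adj, ⟨heq, hn⟩ | ⟨heq, hn⟩⟩ := id hfg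
    · dsimp only at *
      subst heq
      have h1 : H.Adj a f1 := ih.1.adj hab
      have h2 : H.Adj f2 a := ih.2.adj hca
      have h3 : H.Adj g2 a := by
        by_contra hno
        refine hb (((hf.tail hfg).tail (c := (f1, a)) ?_).trans ih.1.swap.symm)
        exact ⟨hg_adj, h1.symm, Or.inl ⟨rfl, hno⟩⟩
      exact ⟨ih.1, ih.2.tail ⟨h2, h3, Or.inr ⟨rfl, hn⟩⟩⟩
    · dsimp only at *
      subst heq
      have h1 : H.Adj a f1 := ih.1.adj hab
      have h2 : H.Adj f2 a := ih.2.adj hca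
      have h3 : H.Adj a g1 := by
        by_contra hno
        refine hc (((hf.tail hfg).tail (c := (a, f2)) ?_).trans ih.2.swap.symm)
        exact ⟨hg_adj, h2.symm, Or.inr ⟨rfl, fun h => hno h.symm⟩⟩
      exact ⟨ih.1.tail ⟨h1, h3, Or.inl ⟨rfl, hn⟩⟩, ih.2⟩

/-- Consecutive pairs along a 2-chordless walk. -/
def ChordlessStep (H : SimpleGraph V) (e f : V × V) : Prop :=
  e.2 = f.1 ∧ H.Adj e.1 e.2 ∧ H.Adj f.1 f.2 ∧ ¬ H.Adj e.1 f.2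

theorem Forces.exists_chordlessStep {e f : V × V} (h : Forces H e f) :
    ∃ m, ChordlessStep H e m ∧ ChordlessStep H m f := by
  obtain ⟨e1, e2⟩ := e
  obtain ⟨f1, f2⟩ := f
  obtain ⟨he, hf, ⟨heq, hn⟩ | ⟨heq, hn⟩⟩ := h <;> dsimp only at * <;> subst heq
  · exact ⟨(e2, e1), ⟨rfl, he, he.symm, H.irrefl⟩, ⟨rfl, he.symm, hf, hn⟩⟩
  · exact ⟨(e2, f1), ⟨rfl, he, hf.symm, hn⟩, ⟨rfl, hf.symm, hf, H.irrefl⟩⟩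

theorem SameClass.exists_chordless_walk {e f : V × V} (h : SameClass H e f) :
    ∃ (n : ℕ) (d : ℕ → V × V), d 0 = e ∧ d (2 * n) = f ∧
      ∀ i < 2 * n, ChordlessStep H (d i) (d (i + 1)) := by
  induction h using Relation.ReflTransGen.head_induction_on with
  | refl => exact ⟨0, fun _ => f, rfl, rfl, by simp⟩
  | @head e g heg _ ih =>
    obtain ⟨n, d, h0, hn, hd⟩ := ih
    obtain ⟨m, hem, hmg⟩ := heg.exists_chordlessStep
    refine ⟨n + 1, fun | 0 => e | 1 => m | i + 2 => d i, rfl, hn, fun i hi => ?_⟩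
    match i with
    | 0 => exact hem
    | 1 => simpa [h0] using hmg
    | i + 2 => exact hd i (by omega)

theorem hasOdd2ChordlessCycle_of_closed_walk {n : ℕ} (hn : Odd n) {d : ℕ → V × V}
    (h0 : d n = d 0) (hd : ∀ i < n, ChordlessStep H (d i) (d (i + 1))) :
    HasOdd2ChordlessCycle H := by
  have : NeZero n := ⟨hn.pos.ne'⟩
  have step : ∀ i, ChordlessStep H (d (i % n)) (d ((i + 1) % n)) := fun i => by
    have hi := Nat.mod_lt i hn.pos
    have := hd _ hi
    rw [← Nat.mod_add_mod]
    rcases (Nat.succ_le_of_lt hi).lt_or_eq with h | h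
    · rwa [Nat.mod_eq_of_lt h]
    · rw [← Nat.succ_eq_add_one, h] at this ⊢
      rwa [Nat.mod_self, ← h0]
  have val_add : ∀ (j : ZMod n) (m : ℕ), (j + m).val = (j.val + m) % n := fun j m => by
    rw [ZMod.val_add, ZMod.val_natCast, Nat.add_mod_mod]
  refine ⟨n, hn, fun j => (d j.val).1, fun j => ?_, fun j => ?_⟩
  · have h1 := step j.val
    rw [Nat.mod_eq_of_lt j.val_lt, ← val_add, Nat.cast_one] at h1
    dsimp only
    rw [← h1.1]
    exact h1.2.1
  · have h1 := step j.val
    have h2 := step (j.val + 1)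
    rw [Nat.mod_eq_of_lt j.val_lt] at h1
    rw [add_assoc, ← val_add j (1 + 1)] at h2
    have h3 : j + ((1 + 1 : ℕ) : ZMod n) = j + 2 := by norm_num
    rw [h3] at h2
    dsimp only
    rw [← h2.1]
    exact h1.2.2.2

theorem hasOdd2ChordlessCycle_of_sameClass_swap {e : V × V} (he : H.Adj e.1 e.2)
    (h : SameClass H e e.swap) : HasOdd2ChordlessCycle H := by
  obtain ⟨n, d, h0, hn, hd⟩ := h.exists_chordless_walk
  refine hasOdd2ChordlessCycle_of_closed_walk (n := 2 * n + 1) ⟨n, rfl⟩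
    (d := fun i => if i ≤ 2 * n then d i else e) (by simp [h0]) fun i hi => ?_
  rcases (Nat.lt_succ_iff.1 hi).lt_or_eq with h | rfl
  · have h' : i + 1 ≤ 2 * n := h
    simpa [h.le, h'] using hd i h
  · have hstep : ChordlessStep H e.swap e := ⟨rfl, he.symm, he, H.irrefl⟩
    simpa [hn] using hstep

/-- A pair whose class contains the lexicographically least pair among those in its class or
in the reversed class. -/
def LexChosen [LinearOrder V] (H : SimpleGraph V) (e : V × V) : Prop :=
  H.Adj e.1 e.2 ∧ ∃ p, SameClass H e p ∧
    ∀ q, SameClass H e q ∨ SameClass H e q.swap → toLex p ≤ toLex q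

theorem LexChosen.of_sameClass [LinearOrder V] {e f : V × V} (h : LexChosen H e)
    (hef : SameClass H e f) : LexChosen H f := by
  obtain ⟨he, p, hp, hmin⟩ := h
  exact ⟨hef.adj he, p, hef.symm.trans hp,
    fun q hq => hmin q (hq.imp hef.trans hef.trans)⟩

theorem LexChosen.not_swap [LinearOrder V]
    (hH : ∀ e : V × V, H.Adj e.1 e.2 → ¬ SameClass H e e.swap) {e : V × V}
    (h : LexChosen H e) : ¬ LexChosen H e.swap := by
  rintro ⟨-, q, hq, hqmin⟩
  obtain ⟨he, p, hp, hpmin⟩ := h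
  have hpq : p = q := toLex.injective <|
    le_antisymm (hpmin q (Or.inr (by simpa using hq.swap))) (hqmin p (Or.inr hp.swap))
  subst hpq
  exact hH e he (hp.trans hq.symm)

theorem lexChosen_or_swap [LinearOrder V] [WellFoundedLT V] {e : V × V} (he : H.Adj e.1 e.2) :
    LexChosen H e ∨ LexChosen H e.swap := by
  obtain ⟨p, hp, hmin⟩ := (wellFounded_lt (α := V ×ₗ V)).has_min
    {p | SameClass H e (ofLex p) ∨ SameClass H e (ofLex p).swap} ⟨toLex e, Or.inl .refl⟩
  have hmin' : ∀ q, SameClass H e q ∨ SameClass H e q.swap → p ≤ toLex q :=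
    fun q hq => not_lt.1 (hmin (toLex q) hq)
  rcases hp with hp | hp
  · exact Or.inl ⟨he, ofLex p, hp, hmin'⟩
  · refine Or.inr ⟨he.symm, ofLex p, by simpa using hp.swap, fun q hq => hmin' q ?_⟩
    rcases hq with hq | hq
    · exact Or.inr (by simpa using hq.swap)
    · exact Or.inl (by simpa using hq.swap)

theorem LexChosen.not_sameClass_swap [LinearOrder V]
    (hH : ∀ e : V × V, H.Adj e.1 e.2 → ¬ SameClass H e e.swap) {e f : V × V}
    (he : LexChosen H e) (hf : LexChosen H f) : ¬ SameClass H e f.swap :=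
  fun h => hf.not_swap hH (he.of_sameClass h)

theorem LexChosen.not_cyclic_of_le [LinearOrder V]
    (hH : ∀ e : V × V, H.Adj e.1 e.2 → ¬ SameClass H e e.swap) {a b c : V} {p : V × V}
    (hab : LexChosen H (a, b)) (hbc : LexChosen H (b, c)) (hca : LexChosen H (c, a))
    (hp : SameClass H (b, c) p) (hmin : ∀ q, SameClass H (a, b) q → toLex p ≤ toLex q) :
    False := by
  obtain ⟨b', c'⟩ := p
  obtain ⟨hab', hca'⟩ := SameClass.triangle hab.1 hca.1
    (hbc.not_sameClass_swap hH hab) (hbc.not_sameClass_swap hH hca) hp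
  dsimp only at hab' hca'
  replace hab := hab.of_sameClass hab'
  replace hbc := hbc.of_sameClass hp
  replace hca := hca.of_sameClass hca'
  obtain ⟨-, ⟨x, y⟩, hxy, hxy_min⟩ := id hab
  have h1 := hmin (x, y) (hab'.trans hxy)
  have h2 := hxy_min (b', a) (Or.inr .refl)
  have hx : x = b' := by
    rw [Prod.Lex.le_iff] at h1 h2
    simp only [ofLex_toLex] at h1 h2
    rcases h1 with h1 | h1 <;> rcases h2 with h2 | h2
    · exact absurd h1 h2.not_gt
    · exact h2.1
    · exact h1.1.symm
    · exact h2.1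
  subst hx
  have := (SameClass.triangle hca.1 hbc.1
    (hab.not_sameClass_swap hH hca) (hab.not_sameClass_swap hH hbc) hxy).1
  exact hca.not_sameClass_swap hH hbc this

theorem LexChosen.not_cyclic [LinearOrder V]
    (hH : ∀ e : V × V, H.Adj e.1 e.2 → ¬ SameClass H e e.swap) {a b c : V}
    (hab : LexChosen H (a, b)) (hbc : LexChosen H (b, c)) (hca : LexChosen H (c, a)) :
    False := by
  obtain ⟨-, p, hp, hpmin⟩ := id hab
  obtain ⟨-, q, hq, hqmin⟩ := id hbc
  obtain ⟨-, r, hr, hrmin⟩ := id hca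
  rcases le_total (toLex q) (toLex p) with hqp | hpq
  · exact LexChosen.not_cyclic_of_le hH hab hbc hca hq
      fun s hs => hqp.trans (hpmin s (Or.inl hs))
  · rcases le_total (toLex p) (toLex r) with hpr | hrp
    · exact LexChosen.not_cyclic_of_le hH hca hab hbc hp
        fun s hs => hpr.trans (hrmin s (Or.inl hs))
    · exact LexChosen.not_cyclic_of_le hH hbc hca hab hr
        fun s hs => (hrp.trans hpq).trans (hqmin s (Or.inl hs))

/-- The Ghouila-Houri and Gilmore-Hoffman theorem: a graph without odd 2-chordless closed walks
has a transitive orientation. -/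
theorem isComparability_of_not_hasOdd2ChordlessCycle (h : ¬ HasOdd2ChordlessCycle H) :
    IsComparability H := by
  obtain ⟨_, _⟩ := exists_wellFoundedLT V
  have hH : ∀ e : V × V, H.Adj e.1 e.2 → ¬ SameClass H e e.swap :=
    fun e he hs => h (hasOdd2ChordlessCycle_of_sameClass_swap he hs)
  refine ⟨{e | LexChosen H e}, fun b c => ⟨fun hbc => ?_, ?_⟩, fun b c z hbc hcz => ?_⟩
  · rcases lexChosen_or_swap (e := (b, c)) hbc with h1 | h1
    · exact Or.inl ⟨h1, h1.not_swap hH⟩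
    · exact Or.inr ⟨h1, h1.not_swap hH⟩
  · rintro (⟨h1, -⟩ | ⟨h1, -⟩)
    · exact h1.1
    · exact h1.1.symm
  · have hbc' : LexChosen H (b, c) := hbc
    have hcz' : LexChosen H (c, z) := hcz
    have hbz : H.Adj b z := by
      by_contra hno
      refine hcz'.not_sameClass_swap hH hbc' (.single ⟨hcz'.1, hbc'.1.symm, Or.inl ⟨rfl, ?_⟩⟩)
      exact fun h => hno h.symm
    rcases lexChosen_or_swap (e := (b, z)) hbz with h1 | h1
    · exact h1
    · exact (LexChosen.not_cyclic hH hbc' hcz' h1).elim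

end Forcing

/-- given P3, a d-tuple of graphs is a packing class iff for each i
there is no induced C₄ in G_i, no odd 2-chordless cycle in the complement of G_i,
and no x_i-infeasible clique in the complement of G_i. -/
theorem packingClass_characterization {V : Type*} [Fintype V] {d : ℕ}
    (w : V → Fin d → ℝ) (hw : ∀ v i, 0 ≤ w v i)
    (G : Fin d → SimpleGraph V)
    (hP3 : ∀ b c : V, ¬ ∀ i, (G i).Adj b c) :
    IsPackingClass w G ↔ ∀ i : Fin d,
      ¬ HasInducedC4 (G i) ∧
      ¬ HasOdd2ChordlessCycle (G i)ᶜ ∧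
      ¬ ∃ S : Finset V, ((G i)ᶜ).IsClique ↑S ∧ 1 < ∑ v ∈ S, w v i := by
  constructor
  · rintro ⟨hI, hS, -⟩ i
    refine ⟨(hI i).not_hasInducedC4, (hI i).isComparability_compl.not_hasOdd2ChordlessCycle, ?_⟩
    rintro ⟨S, hclique, hlt⟩
    exact hlt.not_ge (hS i S fun u hu v hv huv => (hclique hu hv huv).2)
  · intro h
    refine ⟨fun i => ?_, fun i S hS => ?_, hP3⟩
    · exact (isComparability_of_not_hasOdd2ChordlessCycle (h i).2.1).isIntervalGraph_of_compl
        (h i).1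
    · by_contra! hlt
      exact (h i).2.2 ⟨S, fun u hu v hv huv => ⟨huv, hS u hu v hv huv⟩, hlt⟩
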